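/- arXiv:2009.04307 — 3 statements merged into one kernel-verified Lean document; each statement's English description precedes it below -/
import Mathlib

section
/- Let m ∈ ℕ and β ∈ (m−1, m) be real, α ∈ ℕ. Define polynomials Q_α recursively by Q_0(ξ) = ((m−β)ξ + β−m+1)/(β+1) and Q_{α+1}(ξ) = [ξ(1−ξ)·Q_α′(ξ) + (α+β−m+2 + (m−β)ξ)·Q_α(ξ)] / (α+β+2). Then for every α ∈ ℕ: Q_α has degree α+1, Q_α(1) ≠ 0 (indeed Q_{α+1}(1) = ((α+2)/(α+β+2))·Q_α(1)), and for every complex ξ with |ξ| < 1, ℬ(α+1, β+1) · ∑_{n=0}^∞ ξ^n / ℬ(α+1, n+β−m+1) = Q_α(ξ) / (1−ξ)^{α+2}. -/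
/-- The Beta function `ℬ(s,t) = Γ(s)Γ(t)/Γ(s+t)`. -/
noncomputable def Beta (s t : ℝ) : ℝ := Real.Gamma s * Real.Gamma t / Real.Gamma (s + t)

/-- The polynomials `Q_α` of Lemma 1 of the paper, defined recursively by
`Q_0(ξ) = ((m−β)ξ + β−m+1)/(β+1)` and
`Q_{α+1}(ξ) = [ξ(1−ξ)Q_α′(ξ) + (α+β−m+2 + (m−β)ξ)Q_α(ξ)]/(α+β+2)`. -/
noncomputable def Q (m : ℕ) (β : ℝ) : ℕ → Polynomial ℝ
  | 0 => Polynomial.C ((β - m + 1) / (β + 1)) + Polynomial.C ((m - β) / (β + 1)) * Polynomial.X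
  | (α + 1) => Polynomial.C (1 / ((α : ℝ) + β + 2)) *
      (Polynomial.X * (1 - Polynomial.X) * Polynomial.derivative (Q m β α) +
        (Polynomial.C ((α : ℝ) + β - m + 2) + Polynomial.C ((m : ℝ) - β) * Polynomial.X) *
          Q m β α)

theorem Beta_pos {s t : ℝ} (hs : 0 < s) (ht : 0 < t) : 0 < Beta s t :=
  div_pos (mul_pos (Real.Gamma_pos_of_pos hs) (Real.Gamma_pos_of_pos ht))
    (Real.Gamma_pos_of_pos (add_pos hs ht))

theorem Beta_one_left {t : ℝ} (ht : 0 < t) : Beta 1 t = 1 / t := by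
  have h := (Real.Gamma_pos_of_pos ht).ne'
  rw [Beta, add_comm, Real.Gamma_add_one ht.ne', Real.Gamma_one]
  field_simp

theorem Beta_add_one_left {s t : ℝ} (hs : 0 < s) (ht : 0 < t) :
    Beta (s + 1) t = s / (s + t) * Beta s t := by
  have h := (Real.Gamma_pos_of_pos (add_pos hs ht)).ne'
  have hst := (add_pos hs ht).ne'
  rw [Beta, Beta, show s + 1 + t = s + t + 1 by ring, Real.Gamma_add_one hs.ne',
    Real.Gamma_add_one hst]
  field_simp

theorem Beta_add_one_div_Beta_add_one {s t u : ℝ} (hs : 0 < s) (ht : 0 < t) (hu : 0 < u) :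
    Beta (s + 1) t / Beta (s + 1) u = (s + u) / (s + t) * (Beta s t / Beta s u) := by
  have h := (Beta_pos hs hu).ne'
  have hst := (add_pos hs ht).ne'
  have hsu := (add_pos hs hu).ne'
  rw [Beta_add_one_left hs ht, Beta_add_one_left hs hu]
  field_simp

/-- Termwise application of `z * d/dz` to a power series converging on the unit disk. -/
theorem hasSum_natCast_mul_of_hasSum_unitDisk {a : ℕ → ℂ} {G : ℂ → ℂ} {G' z : ℂ}
    (h : ∀ w : ℂ, ‖w‖ < 1 → HasSum (fun n => a n * w ^ n) (G w)) (hz : ‖z‖ < 1)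
    (hG : HasDerivAt G G' z) : HasSum (fun n : ℕ => n * (a n * z ^ n)) (z * G') := by
  obtain ⟨r, hzr, hr⟩ := exists_between hz
  have hr0 : 0 ≤ r := (norm_nonneg z).trans hzr.le
  have hz' : z ∈ Metric.ball (0 : ℂ) r := by simpa using hzr
  have hu : Summable fun n => ‖a n‖ * r ^ n := by
    have := (h r (by simpa [abs_of_nonneg hr0] using hr)).summable.norm
    simpa [abs_of_nonneg hr0] using this
  have key := Complex.hasSum_deriv_of_summable_norm (F := fun n w => a n * w ^ n) hu
    (fun n => by fun_prop) Metric.isOpen_ball (fun n w hw => by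
      have hw' : ‖w‖ < r := by simpa using hw
      rw [norm_mul, norm_pow]
      gcongr) hz'
  have hderiv : deriv (fun w => ∑' n, a n * w ^ n) z = G' := by
    refine (hG.congr_of_eventuallyEq ?_).deriv
    filter_upwards [Metric.isOpen_ball.mem_nhds hz'] with w hw
    exact (h w ((by simpa using hw : ‖w‖ < r).trans hr)).tsum_eq
  rw [hderiv] at key
  refine (key.mul_left z).congr_fun fun n => ?_
  rw [deriv_const_mul_field, deriv_pow_field]
  cases n with
  | zero => simp
  | succ n =>
    rw [Nat.add_sub_cancel]
    ring

theorem Q_succ_eval_one (m : ℕ) (β : ℝ) (α : ℕ) :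
    (Q m β (α + 1)).eval 1 = (((α : ℝ) + 2) / ((α : ℝ) + β + 2)) * (Q m β α).eval 1 := by
  simp only [Q, Polynomial.eval_mul, Polynomial.eval_add, Polynomial.eval_sub, Polynomial.eval_C,
    Polynomial.eval_X, Polynomial.eval_one]
  ring

theorem Q_eval_one_pos {m : ℕ} {β : ℝ} (hβ : -1 < β) (α : ℕ) : 0 < (Q m β α).eval 1 := by
  induction α with
  | zero =>
    have : 0 < β + 1 := by linarith
    have : (Q m β 0).eval 1 = 1 / (β + 1) := by
      simp only [Q, Polynomial.eval_mul, Polynomial.eval_add, Polynomial.eval_C, Polynomial.eval_X]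
      ring
    rw [this]
    positivity
  | succ α ih =>
    rw [Q_succ_eval_one]
    have : (0 : ℝ) ≤ α := α.cast_nonneg
    have : 0 < (α : ℝ) + β + 2 := by linarith
    positivity

theorem Q_natDegree_le (m : ℕ) (β : ℝ) (α : ℕ) : (Q m β α).natDegree ≤ α + 1 := by
  induction α with
  | zero => rw [Q]; compute_degree
  | succ α ih =>
    rw [Q]
    compute_degree
    omega

theorem Q_succ_coeff (m : ℕ) (β : ℝ) (α : ℕ) : (Q m β (α + 1)).coeff (α + 2) =
    (m - β - α - 1) / (α + β + 2) * (Q m β α).coeff (α + 1) := by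
  have h := Polynomial.coeff_eq_zero_of_natDegree_lt (Nat.lt_succ_of_le (Q_natDegree_le m β α))
  rw [Q, Polynomial.coeff_C_mul, mul_assoc, add_mul, mul_assoc, Polynomial.coeff_add,
    Polynomial.coeff_add, Polynomial.coeff_C_mul, Polynomial.coeff_C_mul,
    Polynomial.coeff_X_mul, Polynomial.coeff_X_mul, sub_mul, one_mul, Polynomial.coeff_sub,
    Polynomial.coeff_X_mul, Polynomial.coeff_derivative, Polynomial.coeff_derivative, h]
  push_cast
  ring

theorem Q_coeff_ne_zero {m : ℕ} {β : ℝ} (hβ : (m : ℝ) - 1 < β ∧ β < m) (α : ℕ) :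
    (Q m β α).coeff (α + 1) ≠ 0 := by
  have hm : (0 : ℝ) ≤ m := m.cast_nonneg
  induction α with
  | zero =>
    have : (Q m β 0).coeff 1 = (m - β) / (β + 1) := by simp [Q, Polynomial.coeff_C]
    rw [zero_add, this]
    exact div_ne_zero (by linarith) (by linarith)
  | succ α ih =>
    have hα : (0 : ℝ) ≤ α := α.cast_nonneg
    rw [Q_succ_coeff]
    exact mul_ne_zero (div_ne_zero (by linarith) (by linarith)) ih

theorem Q_degree {m : ℕ} {β : ℝ} (hβ : (m : ℝ) - 1 < β ∧ β < m) (α : ℕ) :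
    (Q m β α).degree = (α + 1 : ℕ) :=
  Polynomial.degree_eq_of_le_of_coeff_ne_zero
    (Polynomial.natDegree_le_iff_degree_le.1 (Q_natDegree_le m β α)) (Q_coeff_ne_zero hβ α)

theorem hasSum_Beta_div_Beta {m : ℕ} {β : ℝ} (hβ : (m : ℝ) - 1 < β) (α : ℕ) (z : ℂ)
    (hz : ‖z‖ < 1) :
    HasSum (fun n : ℕ =>
        ((Beta (α + 1) (β + 1) / Beta (α + 1) (n + β - m + 1) : ℝ) : ℂ) * z ^ n)
      (Polynomial.aeval z (Q m β α) / (1 - z) ^ (α + 2)) := by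
  have hβ0 : 0 < β + 1 := by
    have : (0 : ℝ) ≤ m := m.cast_nonneg
    linarith
  have hn0 (n : ℕ) : 0 < (n : ℝ) + β - m + 1 := by
    have : (0 : ℝ) ≤ n := n.cast_nonneg
    linarith
  have one_sub_ne_zero {z : ℂ} (hz : ‖z‖ < 1) : 1 - z ≠ 0 := by
    intro h
    rw [← sub_eq_zero.1 h, norm_one] at hz
    exact hz.false
  induction α generalizing z with
  | zero =>
    have h1 := hasSum_coe_mul_geometric_of_norm_lt_one hz
    have h2 := (hasSum_geometric_of_norm_lt_one hz).mul_left ((β - m + 1 : ℝ) : ℂ)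
    have hz1 := one_sub_ne_zero hz
    have hβ1 : (β : ℂ) + 1 ≠ 0 := by exact_mod_cast hβ0.ne'
    have hval : Polynomial.aeval z (Q m β 0) / (1 - z) ^ (0 + 2) = ((1 / (β + 1) : ℝ) : ℂ) *
        (z / (1 - z) ^ 2 + ((β - m + 1 : ℝ) : ℂ) * (1 - z)⁻¹) := by
      simp only [Q, map_add, map_mul, Polynomial.aeval_C, Polynomial.aeval_X,
        Complex.coe_algebraMap]
      push_cast
      field_simp
      ring
    rw [hval]
    refine ((h1.add h2).mul_left _).congr_fun fun n => ?_
    rw [Nat.cast_zero, zero_add, Beta_one_left hβ0, Beta_one_left (hn0 n)]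
    push_cast
    field_simp
    ring
  | succ α ih =>
    have hα : (0 : ℝ) ≤ α := α.cast_nonneg
    have hz1 := one_sub_ne_zero hz
    have hc : (α : ℂ) + β + 2 ≠ 0 := by
      exact_mod_cast (by linarith : 0 < (α : ℝ) + β + 2).ne'
    have hG : HasDerivAt (fun w : ℂ => Polynomial.aeval w (Q m β α) / (1 - w) ^ (α + 2))
        (Polynomial.aeval z (Polynomial.derivative (Q m β α)) / (1 - z) ^ (α + 2) +
          (α + 2) * Polynomial.aeval z (Q m β α) / (1 - z) ^ (α + 3)) z := by
      refine (((Q m β α).hasDerivAt_aeval z).fun_div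
        (((hasDerivAt_id' z).const_sub 1).fun_pow (α + 2)) (pow_ne_zero _ hz1)).congr_deriv ?_
      rw [show α + 2 - 1 = α + 1 from rfl]
      push_cast
      field_simp
      ring
    have h1 := hasSum_natCast_mul_of_hasSum_unitDisk ih hz hG
    have h2 := (ih z hz).mul_left ((α + β - m + 2 : ℝ) : ℂ)
    have hval : Polynomial.aeval z (Q m β (α + 1)) / (1 - z) ^ (α + 1 + 2) =
        ((1 / (α + β + 2) : ℝ) : ℂ) *
          (z * (Polynomial.aeval z (Polynomial.derivative (Q m β α)) / (1 - z) ^ (α + 2) +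
            (α + 2) * Polynomial.aeval z (Q m β α) / (1 - z) ^ (α + 3)) +
          ((α + β - m + 2 : ℝ) : ℂ) *
            (Polynomial.aeval z (Q m β α) / (1 - z) ^ (α + 2))) := by
      simp only [Q, map_add, map_mul, map_sub, map_one, Polynomial.aeval_C, Polynomial.aeval_X,
        Complex.coe_algebraMap]
      push_cast
      field_simp
      ring
    rw [hval]
    refine ((h1.add h2).mul_left _).congr_fun fun n => ?_
    rw [Nat.cast_succ, Beta_add_one_div_Beta_add_one (by positivity) hβ0 (hn0 n),
      show (α : ℝ) + 1 + (β + 1) = α + β + 2 by ring]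
    push_cast
    field_simp
    ring

/-- Lemma 1 of the paper: for `m ∈ ℕ`, `β ∈ (m−1, m)` and `α ∈ ℕ`, the polynomial `Q_α`
has degree `α+1`, satisfies `Q_α(1) ≠ 0` (with `Q_{α+1}(1) = ((α+2)/(α+β+2)) Q_α(1)`), and
`ℬ(α+1,β+1) ∑_{n} ξ^n/ℬ(α+1, n+β−m+1) = Q_α(ξ)/(1−ξ)^{α+2}` on the unit disk. -/
theorem stmt2 (m : ℕ) (β : ℝ) (hβ : (m : ℝ) - 1 < β ∧ β < m) (α : ℕ) :
    (Q m β α).degree = (α + 1 : ℕ) ∧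
    (Q m β α).eval 1 ≠ 0 ∧
    (Q m β (α + 1)).eval 1 = (((α : ℝ) + 2) / ((α : ℝ) + β + 2)) * (Q m β α).eval 1 ∧
    ∀ ξ : ℂ, ‖ξ‖ < 1 →
      Summable (fun n : ℕ => ξ ^ n / (Beta ((α : ℝ) + 1) ((n : ℝ) + β - m + 1) : ℂ)) ∧
      (Beta ((α : ℝ) + 1) (β + 1) : ℂ) *
          ∑' n : ℕ, ξ ^ n / (Beta ((α : ℝ) + 1) ((n : ℝ) + β - m + 1) : ℂ)
        = Polynomial.aeval ξ (Q m β α) / (1 - ξ) ^ (α + 2) := by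
  have hm : (0 : ℝ) ≤ m := m.cast_nonneg
  refine ⟨Q_degree hβ α, (Q_eval_one_pos (by linarith) α).ne', Q_succ_eval_one m β α,
    fun ξ hξ => ?_⟩
  have hB : (Beta ((α : ℝ) + 1) (β + 1) : ℂ) ≠ 0 :=
    Complex.ofReal_ne_zero.2 (Beta_pos (by positivity) (by linarith)).ne'
  have h := hasSum_Beta_div_Beta hβ.1 α ξ hξ
  have hfun : (fun n : ℕ =>
      ((Beta (α + 1) (β + 1) / Beta (α + 1) (n + β - m + 1) : ℝ) : ℂ) * ξ ^ n) =
      fun n : ℕ => (Beta ((α : ℝ) + 1) (β + 1) : ℂ) *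
        (ξ ^ n / (Beta ((α : ℝ) + 1) ((n : ℝ) + β - m + 1) : ℂ)) := by
    ext n
    push_cast
    ring
  rw [hfun] at h
  exact ⟨(summable_mul_left_iff hB).1 h.summable, by rw [← tsum_mul_left, h.tsum_eq]⟩
end

section
/- For every real α > −1 and β ∈ (−1, 0), the power series G_{α,β}(ξ) := ∑_{n=0}^∞ ((−1)^n/(n+β)) binom(α+1, n) ξ^n converges on the open unit disk 𝔻, defines a holomorphic function there, and satisfies the differential equation ξ · G_{α,β}′(ξ) = (1−ξ)^{α+1} − β · G_{α,β}(ξ) for all ξ ∈ 𝔻, where G′ denotes the complex derivative. -/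
/-- The generalized binomial coefficient `binom(α, n) = (∏_{k<n} (α−k)) / n!`. -/
noncomputable def genBinom (α : ℝ) (n : ℕ) : ℝ :=
  (∏ k ∈ Finset.range n, (α - k)) / (n.factorial : ℝ)

theorem ofReal_genBinom (a : ℝ) (n : ℕ) : (genBinom a n : ℂ) = Ring.choose (a : ℂ) n := by
  have h : (descPochhammer ℤ n).smeval (a : ℂ) = ∏ k ∈ Finset.range n, ((a : ℂ) - k) := by
    induction n with
    | zero => simp
    | succ n ih =>
      rw [Finset.prod_range_succ, ← ih]
      simp [descPochhammer_succ_right, Polynomial.smeval_mul, Polynomial.smeval_natCast]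
  rw [Ring.choose_eq_smul, h, genBinom]
  push_cast
  rw [smul_eq_mul, div_eq_inv_mul]

/-- The binomial series for `(1 - ξ) ^ a` on the open unit disk. -/
theorem hasSum_one_sub_cpow (a : ℝ) {ξ : ℂ} (hξ : ‖ξ‖ < 1) :
    HasSum (fun n : ℕ => (-1) ^ n * (genBinom a n : ℂ) * ξ ^ n) ((1 - ξ) ^ (a : ℂ)) := by
  have hmem : -ξ ∈ Metric.eball (0 : ℂ) 1 := by
    rw [← ENNReal.ofReal_one, Metric.eball_ofReal]
    simpa using hξ
  have h := (Complex.one_add_cpow_hasFPowerSeriesOnBall_zero (a := (a : ℂ))).hasSum hmem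
  rw [zero_add, ← sub_eq_add_neg] at h
  refine h.congr_fun fun n => ?_
  rw [binomialSeries_apply, ofReal_genBinom]
  simp only [List.ofFn_const, List.prod_replicate, smul_eq_mul, neg_pow ξ n]
  ring

theorem summable_norm_genBinom_mul_pow (a : ℝ) {r : ℝ} (hr₀ : 0 ≤ r) (hr₁ : r < 1) :
    Summable fun n : ℕ => ‖(genBinom a n : ℂ)‖ * r ^ n := by
  have hr : ‖(r : ℂ)‖ = r := Complex.norm_of_nonneg hr₀
  have h := (hasSum_one_sub_cpow a (ξ := r) (hr.trans_lt hr₁)).summable.norm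
  simpa only [norm_mul, norm_pow, norm_neg, norm_one, one_pow, one_mul, hr] using h

theorem exists_pos_le_norm_natCast_add {β : ℝ} (hβ : β ∈ Set.Ioo (-1 : ℝ) 0) :
    ∃ m : ℝ, 0 < m ∧ ∀ n : ℕ, m ≤ ‖(n : ℂ) + (β : ℂ)‖ := by
  obtain ⟨h₁, h₂⟩ := hβ
  refine ⟨min (-β) (1 + β), lt_min (by linarith) (by linarith), fun n => ?_⟩
  have hn : ‖(n : ℂ) + (β : ℂ)‖ = |(n : ℝ) + β| := by
    rw [← Real.norm_eq_abs, ← Complex.norm_real]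
    push_cast
    rfl
  rw [hn]
  rcases n with _ | n
  · exact (min_le_left _ _).trans (by simpa using neg_le_abs β)
  · refine (min_le_right _ _).trans (le_trans ?_ (le_abs_self _))
    push_cast
    have : (0 : ℝ) ≤ n := n.cast_nonneg
    linarith

/-- The series `G_{α,β}(ξ) = ∑ ((−1)^n/(n+β)) binom(α+1,n) ξ^n` converges on the open unit
disk, is holomorphic there, and satisfies `ξ G′(ξ) = (1−ξ)^{α+1} − β G(ξ)`. -/
theorem stmt4 (α β : ℝ) (hα : -1 < α) (hβ : β ∈ Set.Ioo (-1 : ℝ) 0) :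
    (∀ ξ : ℂ, ‖ξ‖ < 1 →
      Summable (fun n : ℕ => ((-1) ^ n / ((n : ℂ) + (β : ℂ))) * (genBinom (α + 1) n : ℂ) * ξ ^ n)) ∧
    DifferentiableOn ℂ
      (fun ξ : ℂ => ∑' n : ℕ, ((-1) ^ n / ((n : ℂ) + (β : ℂ))) * (genBinom (α + 1) n : ℂ) * ξ ^ n)
      (Metric.ball 0 1) ∧
    ∀ ξ : ℂ, ‖ξ‖ < 1 →
      ξ * deriv
          (fun ξ : ℂ => ∑' n : ℕ, ((-1) ^ n / ((n : ℂ) + (β : ℂ))) * (genBinom (α + 1) n : ℂ) * ξ ^ n)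
          ξ
        = (1 - ξ) ^ (((α + 1) : ℝ) : ℂ)
          - (β : ℂ) * ∑' n : ℕ, ((-1) ^ n / ((n : ℂ) + (β : ℂ))) * (genBinom (α + 1) n : ℂ) * ξ ^ n := by
  have ⟨m, hm, hmle⟩ := exists_pos_le_norm_natCast_add hβ
  have hsum := fun r hr₀ hr₁ => summable_norm_genBinom_mul_pow (α + 1) (r := r) hr₀ hr₁
  have hbound : ∀ (r : ℝ) (n : ℕ) (w : ℂ), ‖w‖ ≤ r →
      ‖((-1) ^ n / ((n : ℂ) + (β : ℂ))) * (genBinom (α + 1) n : ℂ) * w ^ n‖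
        ≤ m⁻¹ * (‖(genBinom (α + 1) n : ℂ)‖ * r ^ n) := by
    intro r n w hw
    rw [norm_mul, norm_mul, norm_div, norm_pow, norm_pow, norm_neg, norm_one, one_pow, one_div,
      mul_assoc]
    have := hmle n
    gcongr
  have hdiff : ∀ n : ℕ, Differentiable ℂ fun w : ℂ =>
      ((-1) ^ n / ((n : ℂ) + (β : ℂ))) * (genBinom (α + 1) n : ℂ) * w ^ n := by
    intro n
    fun_prop
  have hsummable : ∀ ξ : ℂ, ‖ξ‖ < 1 → Summable (fun n : ℕ =>
      ((-1) ^ n / ((n : ℂ) + (β : ℂ))) * (genBinom (α + 1) n : ℂ) * ξ ^ n) := fun ξ hξ =>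
    .of_norm_bounded ((hsum ‖ξ‖ (norm_nonneg _) hξ).mul_left m⁻¹) fun n => hbound _ n ξ le_rfl
  refine ⟨hsummable, fun ξ hξ => ?_, fun ξ hξ => ?_⟩
  · rw [mem_ball_zero_iff] at hξ
    obtain ⟨r, hξr, hr⟩ := exists_between hξ
    have hr₀ : 0 ≤ r := (norm_nonneg _).trans hξr.le
    have hd := Complex.differentiableOn_tsum_of_summable_norm ((hsum r hr₀ hr).mul_left m⁻¹)
      (fun n => (hdiff n).differentiableOn) (Metric.isOpen_ball (x := (0 : ℂ)) (ε := r))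
      fun n w hw => hbound r n w (mem_ball_zero_iff.1 hw).le
    exact (hd.differentiableAt
      (Metric.isOpen_ball.mem_nhds (mem_ball_zero_iff.2 hξr))).differentiableWithinAt
  · obtain ⟨r, hξr, hr⟩ := exists_between hξ
    have hr₀ : 0 ≤ r := (norm_nonneg _).trans hξr.le
    have hd := Complex.hasSum_deriv_of_summable_norm ((hsum r hr₀ hr).mul_left m⁻¹)
      (fun n => (hdiff n).differentiableOn) (Metric.isOpen_ball (x := (0 : ℂ)) (ε := r))
      (fun n w hw => hbound r n w (mem_ball_zero_iff.1 hw).le) (mem_ball_zero_iff.2 hξr)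
    refine (hd.mul_left ξ).unique ?_
    refine ((hasSum_one_sub_cpow (α + 1) hξ).sub
      ((hsummable ξ hξ).hasSum.mul_left (β : ℂ))).congr_fun fun n => ?_
    have hne : (n : ℂ) + β ≠ 0 := norm_pos_iff.1 (hm.trans_le (hmle n))
    rw [deriv_const_mul_field, deriv_pow_field]
    rcases n with _ | n
    · simp only [Nat.cast_zero, zero_add] at hne
      simp [hne]
    · rw [Nat.add_sub_cancel]
      field_simp
      ring
end

section
/- For every real α > −1, the family of functions ξ ↦ β(1+β)·G_{α,β}(ξ), indexed by β ∈ (−1, 0), converges uniformly on the open unit disk 𝔻 to the constant function 1 as β → 0⁻, and converges uniformly on 𝔻 to the function ξ ↦ (α+1)ξ as β → (−1)⁺. -/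
/-- `G_{α,β}(ξ) = ∑ ((−1)^n/(n+β)) binom(α+1,n) ξ^n`. -/
noncomputable def G (α β : ℝ) (ξ : ℂ) : ℂ :=
  ∑' n : ℕ, ((-1) ^ n / ((n : ℂ) + (β : ℂ))) * (genBinom (α + 1) n : ℂ) * ξ ^ n

theorem genBinom_zero (a : ℝ) : genBinom a 0 = 1 := by simp [genBinom]

theorem genBinom_one (a : ℝ) : genBinom a 1 = a := by simp [genBinom]

theorem genBinom_succ (a : ℝ) (n : ℕ) :
    (n + 1 : ℝ) * genBinom a (n + 1) = (a - n) * genBinom a n := by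
  have h : (n.factorial : ℝ) ≠ 0 := by positivity
  have h' : (n + 1 : ℝ) ≠ 0 := by positivity
  simp only [genBinom, Finset.prod_range_succ, Nat.factorial_succ, Nat.cast_mul, Nat.cast_succ]
  field_simp

/-- For `a > 0` the binomial coefficients are absolutely summable: past `n > a` the sequence
`n * |binom(a, n)|` is decreasing with increments `-a * |binom(a, n)|`. -/
theorem summable_abs_genBinom {a : ℝ} (ha : 0 < a) : Summable fun n => |genBinom a n| := by
  obtain ⟨N, hN⟩ := exists_nat_gt a
  have step (n : ℕ) : a * |genBinom a (n + N)| =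
      (n + N : ℝ) * |genBinom a (n + N)| - (n + 1 + N : ℝ) * |genBinom a (n + 1 + N)| := by
    have h := congrArg abs (genBinom_succ a (n + N))
    have hn : (0 : ℝ) ≤ n := n.cast_nonneg
    push_cast at h
    rw [abs_mul, abs_mul, abs_of_nonneg (by positivity : (0 : ℝ) ≤ n + N + 1),
      abs_of_nonpos (by linarith : a - (n + N : ℝ) ≤ 0)] at h
    rw [show n + 1 + N = n + N + 1 by ring, show (n + 1 + N : ℝ) = n + N + 1 by ring, h]
    ring
  have partialSum (M : ℕ) : a * ∑ n ∈ Finset.range M, |genBinom a (n + N)| =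
      N * |genBinom a N| - (M + N : ℝ) * |genBinom a (M + N)| := by
    induction M with
    | zero => simp
    | succ M ih =>
      rw [Finset.sum_range_succ, mul_add, ih, step]
      push_cast
      ring
  rw [← summable_nat_add_iff N]
  refine summable_of_sum_range_le (c := N * |genBinom a N| / a) (fun n => abs_nonneg _) fun M => ?_
  rw [le_div_iff₀ ha, mul_comm, partialSum]
  have : 0 ≤ (M + N : ℝ) * |genBinom a (M + N)| := by positivity
  linarith

/-- After removal of its first two terms, `β (1 + β) G_{α,β}` is `O(|β| (1 + β))` uniformly on the
unit disk. -/
theorem norm_mul_G_sub_le {α β : ℝ} {ξ : ℂ} (hα : -1 < α) (hβ : β ∈ Set.Ioo (-1 : ℝ) 0)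
    (hξ : ‖ξ‖ ≤ 1) :
    ‖((β * (1 + β) : ℝ) : ℂ) * G α β ξ - ((1 + β : ℂ) - β * ((α + 1) * ξ))‖ ≤
      -β * (1 + β) * ∑' n, |genBinom (α + 1) (n + 2)| := by
  obtain ⟨h1, h0⟩ := hβ
  have hS := (summable_nat_add_iff 2).2 (summable_abs_genBinom (by linarith : 0 < α + 1))
  set f : ℕ → ℂ := fun n =>
    ((-1) ^ n / ((n : ℂ) + (β : ℂ))) * (genBinom (α + 1) n : ℂ) * ξ ^ n with hf
  have bound (n : ℕ) : ‖f (n + 2)‖ ≤ |genBinom (α + 1) (n + 2)| := by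
    have hn : (1 : ℝ) ≤ (n + 2 : ℕ) + β := by
      push_cast
      linarith [n.cast_nonneg (α := ℝ)]
    have hnorm : ‖((n + 2 : ℕ) : ℂ) + (β : ℂ)‖ = (n + 2 : ℕ) + β := by
      rw [← Complex.ofReal_natCast, ← Complex.ofReal_add, Complex.norm_real, Real.norm_eq_abs,
        abs_of_nonneg (by linarith)]
    simp only [hf, norm_mul, norm_div, norm_pow, norm_neg, norm_one, one_pow, hnorm,
      Complex.norm_real, Real.norm_eq_abs]
    calc 1 / (((n + 2 : ℕ) : ℝ) + β) * |genBinom (α + 1) (n + 2)| * ‖ξ‖ ^ (n + 2)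
        ≤ 1 * |genBinom (α + 1) (n + 2)| * 1 := by
          gcongr
          · exact div_le_one_of_le₀ hn (by linarith)
          · exact pow_le_one₀ (norm_nonneg _) hξ
      _ = _ := by ring
  have hfs : Summable f := (summable_nat_add_iff 2).1 (hS.of_norm_bounded bound)
  have hG : G α β ξ = f 0 + f 1 + ∑' n, f (n + 2) := by
    rw [G, ← hfs.sum_add_tsum_nat_add 2, Finset.sum_range_succ, Finset.sum_range_one]
  have hβ0 : (β : ℂ) ≠ 0 := by exact_mod_cast h0.ne
  have hβ1 : (1 + β : ℂ) ≠ 0 := by exact_mod_cast (by linarith : (0 : ℝ) < 1 + β).ne'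
  have key : ((β * (1 + β) : ℝ) : ℂ) * G α β ξ - ((1 + β : ℂ) - β * ((α + 1) * ξ)) =
      ((β * (1 + β) : ℝ) : ℂ) * ∑' n, f (n + 2) := by
    have e0 : f 0 = 1 / β := by simp [hf, genBinom_zero]
    have e1 : f 1 = -((α + 1) * ξ) / (1 + β) := by
      simp [hf, genBinom_one]
      ring
    rw [hG, e0, e1]
    push_cast
    field_simp
    ring
  rw [key, norm_mul, Complex.norm_real, Real.norm_eq_abs, abs_mul, abs_of_neg h0,
    abs_of_pos (by linarith : 0 < 1 + β)]
  exact mul_le_mul_of_nonneg_left (tsum_of_norm_bounded hS.hasSum bound)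
    (mul_nonneg (by linarith) (by linarith))

theorem tendstoUniformlyOn_of_norm_sub_le_mul {ι X E : Type*} [SeminormedAddCommGroup E]
    {F : ι → X → E} {f : X → E} {l : Filter ι} {s : Set X} {u : ι → ℝ} (C : ℝ)
    (hu : Filter.Tendsto u l (nhds 0)) (h : ∀ᶠ i in l, ∀ x ∈ s, ‖F i x - f x‖ ≤ u i * C) :
    TendstoUniformlyOn F f l s := by
  rw [Metric.tendstoUniformlyOn_iff]
  intro ε hε
  have hC : Filter.Tendsto (fun i => u i * C) l (nhds 0) := by simpa using hu.mul_const C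
  filter_upwards [h, hC.eventually_lt_const hε] with i hi hlt x hx
  rw [dist_comm, dist_eq_norm]
  exact (hi x hx).trans_lt hlt

/-- Lemma 3 of the paper: for `α > −1`, the family `β(1+β)G_{α,β}`, `β ∈ (−1,0)`, converges
uniformly on the unit disk to `1` as `β → 0⁻` and to `ξ ↦ (α+1)ξ` as `β → (−1)⁺`. -/
theorem stmt16 (α : ℝ) (hα : -1 < α) :
    TendstoUniformlyOn
      (fun (β : ℝ) (ξ : ℂ) => ((β * (1 + β) : ℝ) : ℂ) * G α β ξ)
      (fun _ : ℂ => 1)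
      (nhdsWithin 0 (Set.Ioo (-1 : ℝ) 0)) (Metric.ball 0 1) ∧
    TendstoUniformlyOn
      (fun (β : ℝ) (ξ : ℂ) => ((β * (1 + β) : ℝ) : ℂ) * G α β ξ)
      (fun ξ : ℂ => ((α : ℂ) + 1) * ξ)
      (nhdsWithin (-1) (Set.Ioo (-1 : ℝ) 0)) (Metric.ball 0 1) := by
  have hS : 0 ≤ ∑' n, |genBinom (α + 1) (n + 2)| := tsum_nonneg fun _ => abs_nonneg _
  have hnorm : ‖(α + 1 : ℂ)‖ = α + 1 := by
    rw [← Complex.ofReal_one, ← Complex.ofReal_add, Complex.norm_real, Real.norm_eq_abs,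
      abs_of_pos (by linarith)]
  have hlin {ξ : ℂ} (hξ : ‖ξ‖ ≤ 1) : ‖(α + 1 : ℂ) * ξ‖ ≤ α + 1 := by
    rw [norm_mul, hnorm]
    exact mul_le_of_le_one_right (by linarith) hξ
  set S := ∑' n, |genBinom (α + 1) (n + 2)|
  constructor
  · refine tendstoUniformlyOn_of_norm_sub_le_mul (u := fun β => -β) (1 + (α + 1) + S) ?_ ?_
    · refine tendsto_nhdsWithin_of_tendsto_nhds ?_
      simpa using (continuous_neg (G := ℝ)).tendsto 0
    filter_upwards [self_mem_nhdsWithin] with β hβ ξ hξ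
    have hξ1 : ‖ξ‖ ≤ 1 := (mem_ball_zero_iff.1 hξ).le
    have hβ' : ‖(β : ℂ)‖ = -β := by
      rw [Complex.norm_real, Real.norm_eq_abs, abs_of_neg hβ.2]
    calc _ = ‖(((β * (1 + β) : ℝ) : ℂ) * G α β ξ - ((1 + β : ℂ) - β * ((α + 1) * ξ))) +
            β * (1 - (α + 1) * ξ)‖ := by congr 1; ring
      _ ≤ -β * (1 + β) * S + -β * (1 + (α + 1)) := by
        refine norm_add_le_of_le (norm_mul_G_sub_le hα hβ hξ1) ?_
        rw [norm_mul, hβ']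
        refine mul_le_mul_of_nonneg_left ?_ (by linarith [hβ.2])
        exact norm_sub_le_of_le (by simp) (hlin hξ1)
      _ ≤ _ := by nlinarith [mul_nonneg (sq_nonneg β) hS]
  · refine tendstoUniformlyOn_of_norm_sub_le_mul (u := fun β => 1 + β) (1 + (α + 1) + S) ?_ ?_
    · refine tendsto_nhdsWithin_of_tendsto_nhds ?_
      simpa using (continuous_const_add (1 : ℝ)).tendsto (-1)
    filter_upwards [self_mem_nhdsWithin] with β hβ ξ hξ
    have hξ1 : ‖ξ‖ ≤ 1 := (mem_ball_zero_iff.1 hξ).le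
    have hβ' : ‖(1 + β : ℂ)‖ = 1 + β := by
      rw [← Complex.ofReal_one, ← Complex.ofReal_add, Complex.norm_real, Real.norm_eq_abs,
        abs_of_pos (by linarith [hβ.1])]
    calc _ = ‖(((β * (1 + β) : ℝ) : ℂ) * G α β ξ - ((1 + β : ℂ) - β * ((α + 1) * ξ))) +
            (1 + β) * (1 - (α + 1) * ξ)‖ := by congr 1; ring
      _ ≤ -β * (1 + β) * S + (1 + β) * (1 + (α + 1)) := by
        refine norm_add_le_of_le (norm_mul_G_sub_le hα hβ hξ1) ?_
        rw [norm_mul, hβ']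
        refine mul_le_mul_of_nonneg_left ?_ (by linarith [hβ.1])
        exact norm_sub_le_of_le (by simp) (hlin hξ1)
      _ ≤ _ := by nlinarith [mul_nonneg (sq_nonneg (1 + β)) hS]
end
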